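/- If the sequent Γ ⇒ Δ is derivable in SC_TML, then for every tetravalent modal algebra A and every homomorphism h from formulas to A, the infimum of {h(γ) : γ ∈ Γ} is ≤ the supremum of {h(δ) : δ ∈ Δ} (with empty infimum 1 and empty supremum 0). -/

import Mathlib

/-- A tetravalent modal algebra: a bounded distributive lattice with bottom `⊥` (= 0) and
top `⊤` (= ¬0), a De Morgan negation `compl` and a modal operator `box` satisfying
`□a ⊓ ¬a = 0` and `¬□a ⊓ a = ¬a ⊓ a`. -/
class TMA (α : Type*) extends DistribLattice α, BoundedOrder α where
  compl : α → α
  box : α → α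
  compl_compl : ∀ a : α, compl (compl a) = a
  compl_sup : ∀ a b : α, compl (a ⊔ b) = compl a ⊓ compl b
  compl_bot : compl (⊥ : α) = ⊤
  box_inf_compl : ∀ a : α, box a ⊓ compl a = ⊥
  compl_box_inf : ∀ a : α, compl (box a) ⊓ a = compl a ⊓ a
/-- Formulas built from propositional variables by the connectives `∧`, `∨`, `¬`, `□`
(no `⊥`). -/
inductive Formula : Type where
  | var : ℕ → Formula
  | and : Formula → Formula → Formula
  | or : Formula → Formula → Formula
  | neg : Formula → Formula
  | box : Formula → Formula
deriving DecidableEq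
/-- The two-sided sequent calculus `SC_TML`.  `SCder c Γ Δ` means the sequent `Γ ⇒ Δ`
has a derivation; when `c = false` the cut rule is not allowed (cut-free derivability),
`SCder true` is plain derivability. -/
inductive SCder : Bool → Finset Formula → Finset Formula → Prop where
  | ax (c : Bool) (α : Formula) : SCder c {α} {α}
  | weakL {c Γ Δ} (α : Formula) : SCder c Γ Δ → SCder c (insert α Γ) Δ
  | weakR {c Γ Δ} (α : Formula) : SCder c Γ Δ → SCder c Γ (insert α Δ)
  | cut {Γ Δ : Finset Formula} {α : Formula} :
      SCder true Γ (insert α Δ) → SCder true (insert α Γ) Δ → SCder true Γ Δ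
  | andL {c Γ Δ} (α β : Formula) :
      SCder c (insert α (insert β Γ)) Δ → SCder c (insert (α.and β) Γ) Δ
  | andR {c Γ Δ} (α β : Formula) :
      SCder c Γ (insert α Δ) → SCder c Γ (insert β Δ) → SCder c Γ (insert (α.and β) Δ)
  | nandL {c Γ Δ} (α β : Formula) :
      SCder c (insert α.neg Γ) Δ → SCder c (insert β.neg Γ) Δ →
      SCder c (insert (α.and β).neg Γ) Δ
  | nandR {c Γ Δ} (α β : Formula) :
      SCder c Γ (insert α.neg (insert β.neg Δ)) → SCder c Γ (insert (α.and β).neg Δ)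
  | orL {c Γ Δ} (α β : Formula) :
      SCder c (insert α Γ) Δ → SCder c (insert β Γ) Δ → SCder c (insert (α.or β) Γ) Δ
  | orR {c Γ Δ} (α β : Formula) :
      SCder c Γ (insert α (insert β Δ)) → SCder c Γ (insert (α.or β) Δ)
  | norL {c Γ Δ} (α β : Formula) :
      SCder c (insert α.neg (insert β.neg Γ)) Δ → SCder c (insert (α.or β).neg Γ) Δ
  | norR {c Γ Δ} (α β : Formula) :
      SCder c Γ (insert α.neg Δ) → SCder c Γ (insert β.neg Δ) →
      SCder c Γ (insert (α.or β).neg Δ)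
  | nnL {c Γ Δ} (α : Formula) : SCder c (insert α Γ) Δ → SCder c (insert α.neg.neg Γ) Δ
  | nnR {c Γ Δ} (α : Formula) : SCder c Γ (insert α Δ) → SCder c Γ (insert α.neg.neg Δ)
  | boxL1 {c Γ Δ} (α : Formula) : SCder c (insert α Γ) Δ → SCder c (insert α.box Γ) Δ
  | boxL2 {c Γ Δ} (α : Formula) : SCder c Γ (insert α.neg Δ) → SCder c (insert α.box Γ) Δ
  | boxR {c Γ Δ} (α : Formula) :
      SCder c Γ (insert α Δ) → SCder c (insert α.neg Γ) Δ → SCder c Γ (insert α.box Δ)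
  | nboxL {c Γ Δ} (α : Formula) :
      SCder c Γ (insert α Δ) → SCder c (insert α.neg Γ) Δ → SCder c (insert α.box.neg Γ) Δ
  | nboxR1 {c Γ Δ} (α : Formula) : SCder c (insert α Γ) Δ → SCder c Γ (insert α.box.neg Δ)
  | nboxR2 {c Γ Δ} (α : Formula) : SCder c Γ (insert α.neg Δ) → SCder c Γ (insert α.box.neg Δ)

/-- A homomorphism from the algebra of (⊥-free) formulas to a TMA `A`. -/
structure TMAHomF (A : Type) [TMA A] where
  toFun : Formula → A
  map_and : ∀ φ ψ : Formula, toFun (φ.and ψ) = toFun φ ⊓ toFun ψ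
  map_or : ∀ φ ψ : Formula, toFun (φ.or ψ) = toFun φ ⊔ toFun ψ
  map_neg : ∀ φ : Formula, toFun φ.neg = TMA.compl (toFun φ)
  map_box : ∀ φ : Formula, toFun φ.box = TMA.box (toFun φ)

namespace TMA

variable {A : Type*} [TMA A]

theorem compl_inf (a b : A) : compl (a ⊓ b) = compl a ⊔ compl b := by
  rw [← compl_compl (compl a ⊔ compl b), compl_sup, compl_compl, compl_compl]

theorem box_sup_compl (a : A) : box a ⊔ compl a = a ⊔ compl a := by
  have h := congrArg compl (compl_box_inf a)
  rwa [compl_inf, compl_inf, compl_compl, compl_compl] at h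

theorem compl_box_sup (a : A) : compl (box a) ⊔ a = ⊤ := by
  have h := congrArg compl (box_inf_compl a)
  rwa [compl_inf, compl_compl, compl_bot] at h

theorem box_le (a : A) : box a ≤ a :=
  le_of_inf_le_sup_le (z := compl a) ((box_inf_compl a).trans_le bot_le)
    (box_sup_compl a).le

theorem compl_le_compl_box (a : A) : compl a ≤ compl (box a) := by
  have h := congrArg compl (inf_eq_right.mpr (box_le a))
  rw [compl_inf] at h
  exact sup_eq_right.mp h

theorem le_box_sup_compl (a : A) : a ≤ box a ⊔ compl a :=
  le_sup_left.trans (box_sup_compl a).ge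

theorem compl_box_inf_le_compl (a : A) : compl (box a) ⊓ a ≤ compl a :=
  (compl_box_inf a).trans_le inf_le_left

end TMA

/-- The cut rule in a distributive lattice. -/
theorem le_of_le_sup_of_inf_le {A : Type*} [DistribLattice A] {g d a : A}
    (h₁ : g ≤ a ⊔ d) (h₂ : a ⊓ g ≤ d) : g ≤ d :=
  le_of_inf_le_sup_le (z := a) (le_inf ((inf_comm g a).trans_le h₂) inf_le_right)
    (sup_le (h₁.trans_eq (sup_comm a d)) le_sup_right)

/-- Soundness of `SC_TML` over every tetravalent modal algebra: if `Γ ⇒ Δ` is derivable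
then `inf h(Γ) ≤ sup h(Δ)` (empty infimum `⊤ = 1`, empty supremum `⊥ = 0`). -/
theorem sc_sound_tma (Γ Δ : Finset Formula) (h : SCder true Γ Δ) :
    ∀ (A : Type) [TMA A], ∀ f : TMAHomF A, Γ.inf f.toFun ≤ Δ.sup f.toFun := by
  intro A _ f
  generalize true = c at h
  induction h <;>
    simp only [Finset.inf_insert, Finset.sup_insert, Finset.inf_singleton, Finset.sup_singleton,
      f.map_and, f.map_or, f.map_neg, f.map_box, TMA.compl_inf, TMA.compl_sup,
      TMA.compl_compl, inf_assoc, sup_assoc] at *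
  case ax => exact le_rfl
  case weakL ih => exact inf_le_right.trans ih
  case weakR ih => exact ih.trans le_sup_right
  case cut ih₁ ih₂ => exact le_of_le_sup_of_inf_le ih₁ ih₂
  case andL ih => exact ih
  case andR ih₁ ih₂ => rw [sup_inf_right]; exact le_inf ih₁ ih₂
  case nandL ih₁ ih₂ => rw [inf_sup_right]; exact sup_le ih₁ ih₂
  case nandR ih => exact ih
  case orL ih₁ ih₂ => rw [inf_sup_right]; exact sup_le ih₁ ih₂
  case orR ih => exact ih
  case norL ih => exact ih
  case norR ih₁ ih₂ => rw [sup_inf_right]; exact le_inf ih₁ ih₂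
  case nnL ih => exact ih
  case nnR ih => exact ih
  case boxL1 α _ ih => exact (inf_le_inf_right _ (TMA.box_le _)).trans ih
  case boxL2 α _ ih =>
    refine le_of_le_sup_of_inf_le (inf_le_right.trans ih) ?_
    rw [← inf_assoc, inf_comm (TMA.compl _), TMA.box_inf_compl, bot_inf_eq]
    exact bot_le
  case boxR α _ _ ih₁ ih₂ =>
    refine le_of_le_sup_of_inf_le (a := TMA.compl (f.toFun α)) ?_ (ih₂.trans le_sup_right)
    rw [sup_left_comm, ← sup_assoc]
    exact ih₁.trans (sup_le_sup_right (TMA.le_box_sup_compl _) _)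
  case nboxL α _ _ ih₁ ih₂ =>
    refine le_of_le_sup_of_inf_le (inf_le_right.trans ih₁) ?_
    rw [inf_left_comm, ← inf_assoc]
    exact (inf_le_inf_right _ (TMA.compl_box_inf_le_compl _)).trans ih₂
  case nboxR1 α _ ih =>
    refine le_of_le_sup_of_inf_le (a := f.toFun α) ?_ (ih.trans le_sup_right)
    rw [sup_left_comm, ← sup_assoc, TMA.compl_box_sup, top_sup_eq]
    exact le_top
  case nboxR2 α _ ih => exact ih.trans (sup_le_sup_right (TMA.compl_le_compl_box _) _)
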